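/- Let L, L', M, M' be finite lists of positive integers, and for a quaternion q = r + x𝐢 + y𝐣 + z𝐤 write Re(q) = r, Im_𝐢(q) = x, Im_𝐣(q) = y. If Re(γ(L))²·√2 + Im_𝐢(γ(L))²·√3 + Im_𝐣(γ(L))²·√5 + Re(γ(M))²·√7 + Im_𝐢(γ(M))²·√11 + Im_𝐣(γ(M))²·√13 = Re(γ(L'))²·√2 + Im_𝐢(γ(L'))²·√3 + Im_𝐣(γ(L'))²·√5 + Re(γ(M'))²·√7 + Im_𝐢(γ(M'))²·√11 + Im_𝐣(γ(M'))²·√13, then L = L' and M = M'. -/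

import Mathlib

open Quaternion

/-- The unit quaternion `q_a = (3 + 4𝐢)/5`. -/
noncomputable def qa : ℍ[ℝ] := ⟨3/5, 4/5, 0, 0⟩

/-- The unit quaternion `q_b = (3 + 4𝐣)/5`. -/
noncomputable def qb : ℍ[ℝ] := ⟨3/5, 0, 4/5, 0⟩

/-- For a finite list `L = (k₁, …, k_t)` of positive integers,
`γ(L) = (q_a^{k₁} q_b)(q_a^{k₂} q_b)⋯(q_a^{k_t} q_b)`, with `γ([]) = 1`. -/
noncomputable def gamma (L : List ℕ+) : ℍ[ℝ] :=
  (L.map fun k => qa ^ (k : ℕ) * qb).prod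

section SquareRoots

/-- Elements of a subfield with a square root `s` adjoined have the form `a + b * s`. -/
theorem exists_eq_add_mul_of_mem_closure_insert {K : Type*} [Field K] {F : Subfield K} {s : K}
    (hs : s ^ 2 ∈ F) {x : K} (hx : x ∈ Subfield.closure (insert s (F : Set K))) :
    ∃ a ∈ F, ∃ b ∈ F, x = a + b * s := by
  induction hx using Subfield.closure_induction with
  | mem x hx =>
    rcases hx with rfl | hx
    · exact ⟨0, F.zero_mem, 1, F.one_mem, by ring⟩
    · exact ⟨x, hx, 0, F.zero_mem, by ring⟩
  | one => exact ⟨1, F.one_mem, 0, F.zero_mem, by ring⟩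
  | add x y _ _ hx hy =>
    obtain ⟨a, ha, b, hb, rfl⟩ := hx
    obtain ⟨c, hc, d, hd, rfl⟩ := hy
    exact ⟨a + c, F.add_mem ha hc, b + d, F.add_mem hb hd, by ring⟩
  | neg x _ hx =>
    obtain ⟨a, ha, b, hb, rfl⟩ := hx
    exact ⟨-a, F.neg_mem ha, -b, F.neg_mem hb, by ring⟩
  | mul x y _ _ hx hy =>
    obtain ⟨a, ha, b, hb, rfl⟩ := hx
    obtain ⟨c, hc, d, hd, rfl⟩ := hy
    exact ⟨a * c + b * d * s ^ 2, F.add_mem (F.mul_mem ha hc) (F.mul_mem (F.mul_mem hb hd) hs),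
      a * d + b * c, F.add_mem (F.mul_mem ha hd) (F.mul_mem hb hc), by ring⟩
  | inv x _ hx =>
    obtain ⟨a, ha, b, hb, rfl⟩ := hx
    by_cases hsF : s ∈ F
    · exact ⟨(a + b * s)⁻¹, F.inv_mem (F.add_mem ha (F.mul_mem hb hsF)), 0, F.zero_mem, by ring⟩
    by_cases hb0 : b = 0
    · exact ⟨a⁻¹, F.inv_mem ha, 0, F.zero_mem, by simp [hb0]⟩
    have hne : ∀ c ∈ F, c + b * s ≠ 0 := fun c hc h ↦ hsF <| by
      have : s = -c / b := by field_simp; linear_combination h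
      exact this ▸ F.div_mem (F.neg_mem hc) hb
    have h₁ := hne a ha
    have h₂ : a - b * s ≠ 0 := fun h ↦ hne (-a) (F.neg_mem ha) (by linear_combination -h)
    have hd : a ^ 2 - b ^ 2 * s ^ 2 ∈ F :=
      F.sub_mem (F.pow_mem ha 2) (F.mul_mem (F.pow_mem hb 2) hs)
    have hd0 : a ^ 2 - b ^ 2 * s ^ 2 ≠ 0 := by
      rw [show a ^ 2 - b ^ 2 * s ^ 2 = (a + b * s) * (a - b * s) by ring]
      exact mul_ne_zero h₁ h₂
    refine ⟨a / (a ^ 2 - b ^ 2 * s ^ 2), F.div_mem ha hd,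
      -b / (a ^ 2 - b ^ 2 * s ^ 2), F.div_mem (F.neg_mem hb) hd, ?_⟩
    rw [inv_eq_one_div, div_eq_iff h₁]
    field_simp
    ring

/-- The subfield of `ℝ` generated by the square roots of the members of a list. -/
noncomputable def sqrtField : List ℕ → Subfield ℝ
  | [] => (algebraMap ℚ ℝ).fieldRange
  | p :: l => Subfield.closure (insert (√(p : ℝ)) (sqrtField l : Set ℝ))

theorem sqrtField_le_cons (p : ℕ) (l : List ℕ) : sqrtField l ≤ sqrtField (p :: l) :=
  fun _ hx ↦ Subfield.subset_closure (Set.mem_insert_of_mem _ hx)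

theorem sqrt_mem_sqrtField {p : ℕ} {l : List ℕ} (hp : p ∈ l) : √(p : ℝ) ∈ sqrtField l := by
  induction l with
  | nil => simp at hp
  | cons q l ih =>
    rcases List.mem_cons.1 hp with rfl | hp
    · exact Subfield.subset_closure (Set.mem_insert _ _)
    · exact sqrtField_le_cons q l (ih hp)

/-- If `√m` lies in the field generated by the `√p`, `p ∈ l`, then `m` times a subproduct of `l`
is a square. -/
theorem exists_isSquare_of_sqrt_mem_sqrtField {l : List ℕ} {m : ℕ} (h : √(m : ℝ) ∈ sqrtField l) :
    ∃ T : List ℕ, T ⊆ l ∧ IsSquare (m * T.prod) := by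
  induction l generalizing m with
  | nil =>
    refine ⟨[], List.Subset.refl _, ?_⟩
    by_contra hm
    obtain ⟨q, hq⟩ := h
    exact irrational_sqrt_natCast_iff.2 (by simpa using hm) ⟨q, by simpa using hq⟩
  | cons p l ih =>
    have lift {n : ℕ} (hn : √(n : ℝ) ∈ sqrtField l) :
        ∃ T : List ℕ, T ⊆ p :: l ∧ IsSquare (n * T.prod) := by
      obtain ⟨T, hT, hsq⟩ := ih hn
      exact ⟨T, List.Subset.trans hT (List.subset_cons_self p l), hsq⟩
    have hp2 : √(p : ℝ) ^ 2 = p := Real.sq_sqrt p.cast_nonneg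
    have hm2 : √(m : ℝ) ^ 2 = m := Real.sq_sqrt m.cast_nonneg
    obtain ⟨a, ha, b, hb, hab⟩ :=
      exists_eq_add_mul_of_mem_closure_insert (by rw [hp2]; exact natCast_mem _ p) h
    by_cases hpF : √(p : ℝ) ∈ sqrtField l
    · exact lift (hab ▸ add_mem ha (mul_mem hb hpF))
    by_cases hb0 : b = 0
    · exact lift (by rw [hab, hb0]; simpa using ha)
    by_cases ha0 : a = 0
    · obtain ⟨T, hT, hsq⟩ := ih (m := m * p) <| by
        have : √((m * p : ℕ) : ℝ) = b * p := by
          rw [Nat.cast_mul, Real.sqrt_mul m.cast_nonneg, hab, ha0]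
          linear_combination b * hp2
        exact this ▸ mul_mem hb (natCast_mem _ p)
      exact ⟨p :: T, List.cons_subset_cons p hT, by simpa [mul_assoc] using hsq⟩
    · refine absurd ?_ hpF
      have : √(p : ℝ) = (m - a ^ 2 - b ^ 2 * p) / (2 * a * b) := by
        field_simp
        rw [hab] at hm2
        linear_combination hm2 - b ^ 2 * hp2
      rw [this]
      exact div_mem (sub_mem (sub_mem (natCast_mem _ m) (pow_mem ha 2))
        (mul_mem (pow_mem hb 2) (natCast_mem _ p)))
        (mul_mem (mul_mem (ofNat_mem _ 2) ha) hb)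

/-- The square root of a prime is not in the field generated by square roots of other primes. -/
theorem sqrt_notMem_sqrtField {p : ℕ} {l : List ℕ} (hp : p.Prime) (hl : ∀ q ∈ l, q.Prime)
    (hpl : p ∉ l) : √(p : ℝ) ∉ sqrtField l := by
  intro h
  obtain ⟨T, hT, r, hr⟩ := exists_isSquare_of_sqrt_mem_sqrtField h
  have hpr : p ∣ r := (hp.dvd_mul.1 (hr ▸ dvd_mul_right p T.prod)).elim id id
  obtain ⟨s, rfl⟩ := hpr
  have hpT : p ∣ T.prod :=
    ⟨s * s, Nat.eq_of_mul_eq_mul_left hp.pos (by rw [hr]; ring)⟩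
  obtain ⟨q, hq, hpq⟩ := (hp.prime.dvd_prod_iff).1 hpT
  exact hpl ((Nat.prime_dvd_prime_iff_eq hp (hl q (hT hq))).1 hpq ▸ hT hq)

/-- Square roots of distinct primes are linearly independent over `ℚ`. -/
theorem eq_zero_of_sum_mul_sqrt_eq_zero {l : List ℕ} (hl : ∀ q ∈ l, q.Prime) (hnd : l.Nodup)
    (f : ℕ → ℚ) (h : (l.map fun p ↦ (f p : ℝ) * √(p : ℝ)).sum = 0) : ∀ p ∈ l, f p = 0 := by
  induction l with
  | nil => simp
  | cons p l ih =>
    rw [List.forall_mem_cons] at hl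
    rw [List.nodup_cons] at hnd
    rw [List.map_cons, List.sum_cons] at h
    have hmem : (l.map fun p ↦ (f p : ℝ) * √(p : ℝ)).sum ∈ sqrtField l :=
      list_sum_mem fun x hx ↦ by
        obtain ⟨q, hq, rfl⟩ := List.mem_map.1 hx
        exact mul_mem (SubfieldClass.ratCast_mem _ _) (sqrt_mem_sqrtField hq)
    have hfp : f p = 0 := by
      by_contra hfp
      refine sqrt_notMem_sqrtField hl.1 hl.2 hnd.1 ?_
      have hfp' : (f p : ℝ) ≠ 0 := by exact_mod_cast hfp
      have : √(p : ℝ) = -(l.map fun p ↦ (f p : ℝ) * √(p : ℝ)).sum / f p := by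
        field_simp
        linear_combination h
      rw [this]
      exact div_mem (neg_mem hmem) (SubfieldClass.ratCast_mem _ _)
    refine List.forall_mem_cons.2 ⟨hfp, ih hl.2 hnd.2 ?_⟩
    simpa [hfp] using h

end SquareRoots

section Words

instance fact_prime_five : Fact (Nat.Prime 5) := ⟨Nat.prime_five⟩

/-- The integer quaternions `3 + 4𝐢` (for `true`) and `3 + 4𝐣` (for `false`). -/
def intLetter : Bool → ℍ[ℤ]
  | true => ⟨3, 4, 0, 0⟩
  | false => ⟨3, 0, 4, 0⟩

theorem re_intLetter (x : Bool) : (intLetter x).re = 3 := by cases x <;> rfl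

theorem imI_intLetter (x : Bool) : (intLetter x).imI = bif x then 4 else 0 := by cases x <;> rfl

theorem imJ_intLetter (x : Bool) : (intLetter x).imJ = bif x then 0 else 4 := by cases x <;> rfl

theorem imK_intLetter (x : Bool) : (intLetter x).imK = 0 := by cases x <;> rfl

/-- The unit quaternions `q_a` (for `true`) and `q_b` (for `false`). -/
noncomputable def unitLetter (x : Bool) : ℍ[ℝ] := bif x then qa else qb

theorem unitLetter_eq (x : Bool) :
    (unitLetter x).re = (intLetter x).re / 5 ∧ (unitLetter x).imI = (intLetter x).imI / 5 ∧
      (unitLetter x).imJ = (intLetter x).imJ / 5 ∧ (unitLetter x).imK = (intLetter x).imK / 5 := by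
  cases x <;> simp only [unitLetter, cond_true, cond_false] <;> simp [qa, qb, intLetter]

/-- The product of the letters of a word in `3 + 4𝐢` and `3 + 4𝐣`. -/
def intWord (w : List Bool) : ℍ[ℤ] := (w.map intLetter).prod

theorem intWord_cons (x : Bool) (w : List Bool) :
    intWord (x :: w) = intLetter x * intWord w := by
  simp [intWord]

theorem intLetter_ne_zero (x : Bool) : intLetter x ≠ 0 := fun h ↦ by
  have := congrArg QuaternionAlgebra.re h
  cases x <;> simp [intLetter] at this

theorem normSq_intWord (w : List Bool) : normSq (intWord w) = 25 ^ w.length := by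
  induction w with
  | nil => simp [intWord]
  | cons x w ih =>
    rw [intWord_cons, map_mul, ih, List.length_cons, pow_succ', normSq_def']
    cases x <;> simp [intLetter]

/-- Modulo `5`, a word ending in `3 + 4𝐣` is a nonzero multiple of `(3 + 4𝐢)(3 + 4𝐣)` or of
`3 + 4𝐣`, according to its first letter. -/
theorem intWord_mod_five (x : Bool) (w : List Bool) (h : (x :: w).getLast? ≠ some true) :
    ∃ c : ZMod 5, c ≠ 0 ∧ ((intWord (x :: w)).re : ZMod 5) = c * (bif x then 4 else 3) ∧
      ((intWord (x :: w)).imI : ZMod 5) = c * (bif x then 2 else 0) ∧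
      ((intWord (x :: w)).imJ : ZMod 5) = c * (bif x then 2 else 4) ∧
      ((intWord (x :: w)).imK : ZMod 5) = c * (bif x then 1 else 0) := by
  induction w generalizing x with
  | nil =>
    cases x
    · exact ⟨1, by decide, by
        simp [intWord, re_intLetter, imI_intLetter, imJ_intLetter, imK_intLetter]⟩
    · simp at h
  | cons y w ih =>
    rw [List.getLast?_cons_cons] at h
    obtain ⟨c, hc, h₁, h₂, h₃, h₄⟩ := ih y h
    rw [intWord_cons]
    generalize intWord (y :: w) = q at h₁ h₂ h₃ h₄
    refine ⟨(bif !x && y then 3 else 1) * c, ?_⟩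
    cases x <;> cases y <;>
      simp only [re_intLetter, imI_intLetter, imJ_intLetter, imK_intLetter, Quaternion.re_mul,
        Quaternion.imI_mul, Quaternion.imJ_mul, Quaternion.imK_mul, cond_true, cond_false, Int.cast_add, Int.cast_sub, Int.cast_mul,
        h₁, h₂, h₃, h₄, Bool.not_true, Bool.not_false, Bool.and_true, Bool.and_false] <;>
      clear h₁ h₂ h₃ h₄ <;> revert c <;> decide

theorem intWord_inj_up_to_sign {u v : List Bool} (hu : u.getLast? ≠ some true)
    (hv : v.getLast? ≠ some true) (hlen : u.length = v.length)
    (h : intWord u = intWord v ∨ intWord u = -intWord v) : u = v := by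
  induction u generalizing v with
  | nil => exact (List.length_eq_zero_iff.1 hlen.symm).symm
  | cons x u ih =>
    cases v with
    | nil => simp at hlen
    | cons y v =>
      have tail {z : Bool} {w : List Bool} (hw : (z :: w).getLast? ≠ some true) :
          w.getLast? ≠ some true := by
        cases w with
        | nil => simp
        | cons => rwa [List.getLast?_cons_cons] at hw
      have hxy : x = y := by
        obtain ⟨c, hc, -, hcI, -⟩ := intWord_mod_five x u hu
        obtain ⟨d, hd, -, hdI, -⟩ := intWord_mod_five y v hv
        rcases h with h | h <;> rw [h] at hcI <;>
          simp only [Quaternion.imI_neg, Int.cast_neg, hdI] at hcI <;>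
          clear h hdI <;> cases x <;> cases y <;> first | rfl | (revert c d; decide)
      subst hxy
      rw [intWord_cons, intWord_cons, ← mul_neg] at h
      rw [ih (tail hu) (tail hv) (by simpa using hlen)
        (h.imp (mul_left_cancel₀ (intLetter_ne_zero x)) (mul_left_cancel₀ (intLetter_ne_zero x)))]

/-- The word `a^{k₁} b a^{k₂} b ⋯ a^{k_t} b`, with `a` and `b` encoded by `true` and `false`. -/
def exponentWord : List ℕ+ → List Bool
  | [] => []
  | k :: L => List.replicate k true ++ false :: exponentWord L

theorem getLast?_exponentWord (L : List ℕ+) : (exponentWord L).getLast? ≠ some true := by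
  induction L with
  | nil => simp [exponentWord]
  | cons k L ih =>
    rw [exponentWord, List.getLast?_append]
    cases h : exponentWord L with
    | nil => simp
    | cons => rw [h] at ih; simpa [List.getLast?_cons_cons] using ih

theorem exists_exponentWord_cons (k : ℕ+) (L : List ℕ+) :
    ∃ w, exponentWord (k :: L) = true :: w := by
  obtain ⟨n, hn⟩ := Nat.exists_eq_succ_of_ne_zero k.ne_zero
  exact ⟨List.replicate n true ++ false :: exponentWord L, by
    simp [exponentWord, hn, List.replicate_succ]⟩

theorem replicate_append_cons_inj {α : Type*} {x y : α} (hxy : x ≠ y) {a b : ℕ} {u v : List α}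
    (h : List.replicate a x ++ y :: u = List.replicate b x ++ y :: v) : a = b ∧ u = v := by
  induction a generalizing b with
  | zero => cases b <;> simp_all [List.replicate_succ]
  | succ a ih =>
    cases b with
    | zero => simp_all [List.replicate_succ]
    | succ b => simpa using ih (by simpa [List.replicate_succ] using h)

theorem exponentWord_injective : Function.Injective exponentWord := by
  intro L L' h
  induction L generalizing L' with
  | nil => cases L' <;> simp_all [exponentWord]
  | cons k L ih =>
    cases L' with
    | nil => simp [exponentWord] at h
    | cons k' L' =>
      obtain ⟨hk, hL⟩ := replicate_append_cons_inj (by decide) h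
      rw [PNat.coe_injective hk, ih hL]

theorem gamma_eq_prod_exponentWord (L : List ℕ+) :
    gamma L = ((exponentWord L).map unitLetter).prod := by
  induction L with
  | nil => simp [gamma, exponentWord]
  | cons k L ih =>
    have hcons : gamma (k :: L) = qa ^ (k : ℕ) * qb * gamma L := by simp [gamma]
    rw [hcons, ih]
    simp [exponentWord, unitLetter, mul_assoc]

theorem prod_letters_eq (w : List Bool) :
    let q := (w.map unitLetter).prod
    q.re = (intWord w).re / 5 ^ w.length ∧ q.imI = (intWord w).imI / 5 ^ w.length ∧
      q.imJ = (intWord w).imJ / 5 ^ w.length ∧ q.imK = (intWord w).imK / 5 ^ w.length := by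
  induction w with
  | nil => simp [intWord]
  | cons x w ih =>
    obtain ⟨h₁, h₂, h₃, h₄⟩ := ih
    obtain ⟨l₁, l₂, l₃, l₄⟩ := unitLetter_eq x
    simp only [intWord_cons, List.map_cons, List.prod_cons, Quaternion.re_mul, Quaternion.imI_mul,
      Quaternion.imJ_mul, Quaternion.imK_mul, h₁, h₂, h₃, h₄, l₁, l₂, l₃, l₄, List.length_cons,
      pow_succ, Int.cast_add, Int.cast_sub, Int.cast_mul]
    refine ⟨?_, ?_, ?_, ?_⟩ <;> field_simp

theorem re_intWord_exponentWord_ne_zero (L : List ℕ+) :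
    ((intWord (exponentWord L)).re : ZMod 5) ≠ 0 := by
  cases L with
  | nil =>
    simp only [exponentWord, intWord, List.map_nil, List.prod_nil, Quaternion.re_one]
    decide
  | cons k L =>
    obtain ⟨w, hw⟩ := exists_exponentWord_cons k L
    obtain ⟨c, hc, hre, -⟩ := intWord_mod_five true w (hw ▸ getLast?_exponentWord _)
    rw [hw, hre]
    clear hre
    revert c
    decide

theorem length_le_of_sq_mul_eq {r s : ℤ} {m n : ℕ} (hs : (s : ZMod 5) ≠ 0)
    (h : r ^ 2 * 25 ^ n = s ^ 2 * 25 ^ m) : n ≤ m := by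
  by_contra! hlt
  obtain ⟨d, rfl⟩ := Nat.exists_eq_add_of_lt hlt
  have h' : r ^ 2 * 25 ^ (d + 1) = s ^ 2 := by
    refine mul_right_cancel₀ (pow_ne_zero m (by norm_num : (25 : ℤ) ≠ 0)) ?_
    rw [← h]
    ring
  have h25 : ((25 : ℤ) : ZMod 5) = 0 := by decide
  apply_fun ((↑) : ℤ → ZMod 5) at h'
  rw [Int.cast_mul, Int.cast_pow 25, h25] at h'
  simp only [ne_eq, Nat.add_eq_zero_iff, one_ne_zero, and_false, not_false_eq_true, zero_pow,
    mul_zero, Int.cast_pow] at h'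
  exact hs (pow_eq_zero_iff two_ne_zero |>.1 h'.symm)

/-- A list is determined by the squares of three coordinates of its quaternion. -/
theorem eq_of_gamma_sq_eq {L L' : List ℕ+} (hre : (gamma L).re ^ 2 = (gamma L').re ^ 2)
    (hI : (gamma L).imI ^ 2 = (gamma L').imI ^ 2) (hJ : (gamma L).imJ ^ 2 = (gamma L').imJ ^ 2) :
    L = L' := by
  obtain ⟨h₁, h₂, h₃, -⟩ := prod_letters_eq (exponentWord L)
  obtain ⟨h₁', h₂', h₃', -⟩ := prod_letters_eq (exponentWord L')
  rw [← gamma_eq_prod_exponentWord] at h₁ h₂ h₃ h₁' h₂' h₃'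
  rw [h₁, h₁'] at hre
  rw [h₂, h₂'] at hI
  rw [h₃, h₃'] at hJ
  have clear_denom {r s : ℤ} {m n : ℕ} (h : ((r : ℝ) / 5 ^ m) ^ 2 = ((s : ℝ) / 5 ^ n) ^ 2) :
      r ^ 2 * 25 ^ n = s ^ 2 * 25 ^ m := by
    rw [div_pow, div_pow, div_eq_div_iff (by positivity) (by positivity), ← pow_mul, ← pow_mul,
      mul_comm m, mul_comm n, pow_mul, pow_mul] at h
    norm_num at h
    exact_mod_cast h
  replace hre := clear_denom hre
  replace hI := clear_denom hI
  replace hJ := clear_denom hJ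
  have hlen : (exponentWord L).length = (exponentWord L').length :=
    le_antisymm (length_le_of_sq_mul_eq (re_intWord_exponentWord_ne_zero L) hre.symm)
      (length_le_of_sq_mul_eq (re_intWord_exponentWord_ne_zero L') hre)
  have h25 : (25 : ℤ) ^ (exponentWord L').length ≠ 0 := by positivity
  rw [hlen] at hre hI hJ
  replace hre := mul_right_cancel₀ h25 hre
  replace hI := mul_right_cancel₀ h25 hI
  replace hJ := mul_right_cancel₀ h25 hJ
  have hK : (intWord (exponentWord L)).imK ^ 2 = (intWord (exponentWord L')).imK ^ 2 := by
    have hn := normSq_intWord (exponentWord L)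
    rw [hlen, ← normSq_intWord (exponentWord L'), normSq_def', normSq_def'] at hn
    linear_combination hn - hre - hI - hJ
  refine exponentWord_injective (intWord_inj_up_to_sign (getLast?_exponentWord L)
    (getLast?_exponentWord L') hlen ?_)
  cases L with
  | nil =>
    rw [List.length_eq_zero_iff.1 hlen.symm]
    exact Or.inl rfl
  | cons k L =>
  cases L' with
  | nil => simp [exponentWord] at hlen
  | cons k' L' =>
    obtain ⟨w, hw⟩ := exists_exponentWord_cons k L
    obtain ⟨w', hw'⟩ := exists_exponentWord_cons k' L'
    obtain ⟨c, hc, c₁, c₂, c₃, c₄⟩ := intWord_mod_five true w (hw ▸ getLast?_exponentWord _)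
    obtain ⟨d, hd, d₁, d₂, d₃, d₄⟩ := intWord_mod_five true w' (hw' ▸ getLast?_exponentWord _)
    rw [hw, hw'] at hre hI hJ hK ⊢
    have sign {r s : ℤ} {e : ZMod 5} (he : e ≠ 0) (hr : (r : ZMod 5) = c * e)
        (hs : (s : ZMod 5) = d * e) (h : r ^ 2 = s ^ 2) :
        (c = d ∧ r = s) ∨ (c = -d ∧ r = -s) := by
      rcases sq_eq_sq_iff_eq_or_eq_neg.1 h with rfl | rfl
      · exact Or.inl ⟨mul_right_cancel₀ he (hr.symm.trans hs), rfl⟩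
      · refine Or.inr ⟨mul_right_cancel₀ he ?_, rfl⟩
        rw [← hr, Int.cast_neg, hs, neg_mul]
    have hne : ∀ d : ZMod 5, d ≠ 0 → d ≠ -d := by decide
    have key₁ := sign (by decide) c₁ d₁ hre
    have key₂ := sign (by decide) c₂ d₂ hI
    have key₃ := sign (by decide) c₃ d₃ hJ
    have key₄ := sign (by decide) c₄ d₄ hK
    have hdd := hne d hd
    by_cases hcd : c = d
    · left
      subst hcd
      simp only [hdd, true_and, false_and, or_false] at key₁ key₂ key₃ key₄
      exact Quaternion.ext _ _ key₁ key₂ key₃ key₄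
    · right
      simp only [hcd, false_and, false_or] at key₁ key₂ key₃ key₄
      exact Quaternion.ext _ _ key₁.2 key₂.2 key₃.2 key₄.2

end Words

/-- If the radical combination
`Re(γ(L))²√2 + Im_𝐢(γ(L))²√3 + Im_𝐣(γ(L))²√5 + Re(γ(M))²√7 + Im_𝐢(γ(M))²√11 + Im_𝐣(γ(M))²√13`
agrees for the pairs `(L, M)` and `(L', M')`, then `L = L'` and `M = M'`. -/
theorem gamma_radical_sum_inj (L L' M M' : List ℕ+)
    (h : (gamma L).re ^ 2 * Real.sqrt 2 + (gamma L).imI ^ 2 * Real.sqrt 3 +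
          (gamma L).imJ ^ 2 * Real.sqrt 5 + (gamma M).re ^ 2 * Real.sqrt 7 +
          (gamma M).imI ^ 2 * Real.sqrt 11 + (gamma M).imJ ^ 2 * Real.sqrt 13 =
        (gamma L').re ^ 2 * Real.sqrt 2 + (gamma L').imI ^ 2 * Real.sqrt 3 +
          (gamma L').imJ ^ 2 * Real.sqrt 5 + (gamma M').re ^ 2 * Real.sqrt 7 +
          (gamma M').imI ^ 2 * Real.sqrt 11 + (gamma M').imJ ^ 2 * Real.sqrt 13) :
    L = L' ∧ M = M' := by
  have rational (L : List ℕ+) : ∃ r s t : ℚ,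
      (gamma L).re = r ∧ (gamma L).imI = s ∧ (gamma L).imJ = t := by
    obtain ⟨h₁, h₂, h₃, -⟩ := prod_letters_eq (exponentWord L)
    rw [← gamma_eq_prod_exponentWord] at h₁ h₂ h₃
    exact ⟨(intWord (exponentWord L)).re / 5 ^ (exponentWord L).length,
      (intWord (exponentWord L)).imI / 5 ^ (exponentWord L).length,
      (intWord (exponentWord L)).imJ / 5 ^ (exponentWord L).length,
      by push_cast; exact h₁, by push_cast; exact h₂, by push_cast; exact h₃⟩
  obtain ⟨r, s, t, hr, hs, ht⟩ := rational L
  obtain ⟨r', s', t', hr', hs', ht'⟩ := rational L'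
  obtain ⟨u, v, w, hu, hv, hw⟩ := rational M
  obtain ⟨u', v', w', hu', hv', hw'⟩ := rational M'
  let f : ℕ → ℚ
    | 2 => r ^ 2 - r' ^ 2
    | 3 => s ^ 2 - s' ^ 2
    | 5 => t ^ 2 - t' ^ 2
    | 7 => u ^ 2 - u' ^ 2
    | 11 => v ^ 2 - v' ^ 2
    | 13 => w ^ 2 - w' ^ 2
    | _ => 0
  have hf := eq_zero_of_sum_mul_sqrt_eq_zero (l := [2, 3, 5, 7, 11, 13]) (by norm_num) (by decide)
    f (by
      rw [hr, hs, ht, hr', hs', ht', hu, hv, hw, hu', hv', hw'] at h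
      simp only [List.map_cons, List.map_nil, List.sum_cons, List.sum_nil, f]
      push_cast
      linear_combination h)
  have hsq {x y : ℚ} (hxy : x ^ 2 - y ^ 2 = 0) : (x : ℝ) ^ 2 = (y : ℝ) ^ 2 := by
    exact_mod_cast sub_eq_zero.1 hxy
  constructor
  · apply eq_of_gamma_sq_eq
    · rw [hr, hr']; exact hsq (hf 2 (by simp))
    · rw [hs, hs']; exact hsq (hf 3 (by simp))
    · rw [ht, ht']; exact hsq (hf 5 (by simp))
  · apply eq_of_gamma_sq_eq
    · rw [hu, hu']; exact hsq (hf 7 (by simp))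
    · rw [hv, hv']; exact hsq (hf 11 (by simp))
    · rw [hw, hw']; exact hsq (hf 13 (by simp))
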